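/- arXiv:1812.04432 — 2 statements merged into one kernel-verified Lean document; each statement's English description precedes it below -/
import Mathlib

section
/- Let m ≥ 1, 1 ≤ p < ∞, 0 ≤ k ≤ m, let W be a finite-dimensional normed real vector space, let U, V ⊆ ℝ^m be open sets, and let Ψ : U → V be a bi-Lipschitz homeomorphism with Lipschitz constant C_Ψ and with Ψ^{-1} having Lipschitz constant C_{Ψ^{-1}}. Let ω : V → Λ^k((ℝ^m)^*, W) be measurable with ∫_V |ω|^p < ∞. Define the pullback Ψ*ω for Lebesgue-a.e. x ∈ U (namely at each point x where Ψ is differentiable, which is a.e. by Rademacher's theorem) by (Ψ*ω)(x)(v₁,…,v_k) := ω(Ψ(x))(DΨ(x)v₁,…,DΨ(x)v_k). Then Ψ*ω ∈ L^p(U) and C_{Ψ^{-1}}^{−k} C_Ψ^{−m/p} ‖ω‖_{L^p(V)} ≤ ‖Ψ*ω‖_{L^p(U)} ≤ C_Ψ^{k} C_{Ψ^{-1}}^{m/p} ‖ω‖_{L^p(V)}. -/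
open MeasureTheory ENNReal NNReal Set Filter Topology

noncomputable section

/-- The space of (continuous) `k`-linear maps on `ℝᵐ` with values in `W`, with the operator
norm; alternating forms are singled out by the predicate `IsAlternatingForm` below. -/
abbrev FormSpace (m k : ℕ) (W : Type*) [NormedAddCommGroup W] [NormedSpace ℝ W] :=
  ContinuousMultilinearMap ℝ (fun _ : Fin k => EuclideanSpace ℝ (Fin m)) W

/-- A `k`-linear map is alternating, i.e. belongs to `Λ^k((ℝᵐ)^*, W)`. -/
def IsAlternatingForm {m k : ℕ} {W : Type*} [NormedAddCommGroup W] [NormedSpace ℝ W]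
    (lam : FormSpace m k W) : Prop :=
  ∀ (v : Fin k → EuclideanSpace ℝ (Fin m)) (i j : Fin k), i ≠ j → v i = v j → lam v = 0

/-- The pullback `Ψ^*ω` of a `k`-form `ω` by a Lipschitz map `Ψ`, defined (Lebesgue-a.e. by
Rademacher's theorem) via the derivative of `Ψ`:
`(Ψ^*ω)(x)(v₁,…,v_k) = ω(Ψ x)(DΨ(x)v₁,…,DΨ(x)v_k)`. -/
def formPullback {m k : ℕ} {W : Type*} [NormedAddCommGroup W] [NormedSpace ℝ W]
    (Ψ : EuclideanSpace ℝ (Fin m) → EuclideanSpace ℝ (Fin m))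
    (ω : EuclideanSpace ℝ (Fin m) → FormSpace m k W)
    (x : EuclideanSpace ℝ (Fin m)) : FormSpace m k W :=
  (ω (Ψ x)).compContinuousLinearMap fun _ => fderiv ℝ Ψ x

theorem aux_volume_image_le {m : ℕ} {C : ℝ≥0} {s : Set (EuclideanSpace ℝ (Fin m))}
    {f : EuclideanSpace ℝ (Fin m) → EuclideanSpace ℝ (Fin m)} (hf : LipschitzOnWith C f s) :
    volume (f '' s) ≤ (C : ℝ≥0∞) ^ m * volume s := by
  have h1 : (Measure.hausdorffMeasure (m : ℝ) :
      Measure (EuclideanSpace ℝ (Fin m))).IsAddHaarMeasure := by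
    simpa using MeasureTheory.isAddHaarMeasure_hausdorffMeasure (E := EuclideanSpace ℝ (Fin m))
  have h2 := Measure.isAddLeftInvariant_eq_smul
    (volume : Measure (EuclideanSpace ℝ (Fin m))) (Measure.hausdorffMeasure (m : ℝ))
  have h3 := hf.hausdorffMeasure_image_le (d := (m : ℝ)) (by positivity)
  rw [ENNReal.rpow_natCast] at h3
  rw [h2]
  simp only [Measure.smul_apply, ENNReal.smul_def, smul_eq_mul]
  calc _ ≤ _ := mul_le_mul_right h3 _
    _ = _ := by ring

theorem aux_expand {m : ℕ} {C : ℝ≥0} {U V : Set (EuclideanSpace ℝ (Fin m))}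
    {Ψ Φ : EuclideanSpace ℝ (Fin m) → EuclideanSpace ℝ (Fin m)}
    (hU : IsOpen U)
    (hbij : Set.BijOn Ψ U V) (hinv : ∀ x ∈ U, Φ (Ψ x) = x) (hlipinv : LipschitzOnWith C Φ V)
    {x : EuclideanSpace ℝ (Fin m)} (hx : x ∈ U) (hd : DifferentiableAt ℝ Ψ x)
    (v : EuclideanSpace ℝ (Fin m)) : ‖v‖ ≤ C * ‖fderiv ℝ Ψ x v‖ := by
  have hc : Tendsto (fun n : ℕ => ‖((n : ℝ))‖) atTop atTop := by
    simpa using tendsto_natCast_atTop_atTop (R := ℝ)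
  have h1 := hd.hasFDerivAt.lim v hc
  have h2 := (h1.norm).const_mul (C : ℝ)
  have h3 : Tendsto (fun n : ℕ => x + ((n : ℝ))⁻¹ • v) atTop (𝓝 x) := by
    have := (tendsto_inv_atTop_nhds_zero_nat (𝕜 := ℝ)).smul_const v
    simpa using this.const_add x
  refine ge_of_tendsto h2 ?_
  filter_upwards [h3.eventually (hU.mem_nhds hx), eventually_gt_atTop 0] with n hn hn0
  have h4 := hlipinv.dist_le_mul _ (hbij.mapsTo hn) _ (hbij.mapsTo hx)
  rw [hinv _ hn, hinv _ hx, dist_eq_norm, dist_eq_norm, add_sub_cancel_left, norm_smul] at h4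
  have hn1 : (0 : ℝ) < n := by exact_mod_cast hn0
  rw [norm_smul]
  rw [norm_inv, Real.norm_of_nonneg hn1.le] at h4
  rw [Real.norm_of_nonneg hn1.le]
  have := mul_le_mul_of_nonneg_left h4 hn1.le
  rw [← mul_assoc, mul_inv_cancel₀ hn1.ne', one_mul] at this
  linarith

theorem aux_form_lower {m k : ℕ} {W : Type*} [NormedAddCommGroup W] [NormedSpace ℝ W] {C : ℝ≥0}
    (D : EuclideanSpace ℝ (Fin m) →L[ℝ] EuclideanSpace ℝ (Fin m))
    (hD : ∀ v, ‖v‖ ≤ C * ‖D v‖) (lam : FormSpace m k W) :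
    ‖lam‖ ≤ (C : ℝ) ^ k * ‖lam.compContinuousLinearMap fun _ => D‖ := by
  have hinj : Function.Injective (D : EuclideanSpace ℝ (Fin m) →ₗ[ℝ] EuclideanSpace ℝ (Fin m)) := by
    rw [injective_iff_map_eq_zero]
    intro v hv
    have := hD v
    rw [ContinuousLinearMap.coe_coe] at hv
    rw [hv] at this
    simpa using this
  have hsurj := LinearMap.injective_iff_surjective.1 hinj
  refine ContinuousMultilinearMap.opNorm_le_bound (by positivity) fun w => ?_
  choose g hg using hsurj
  have hg' : ∀ y, D (g y) = y := hg
  have h1 := (lam.compContinuousLinearMap fun _ => D).le_opNorm (fun i => g (w i))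
  have h2 : (lam.compContinuousLinearMap fun _ => D) (fun i => g (w i)) = lam w := by
    rw [ContinuousMultilinearMap.compContinuousLinearMap_apply]
    simp only [hg']
  rw [h2] at h1
  refine h1.trans ?_
  have h3 : ∏ i, ‖g (w i)‖ ≤ ∏ i : Fin k, ((C : ℝ) * ‖w i‖) := by
    refine Finset.prod_le_prod (fun _ _ => norm_nonneg _) fun i _ => ?_
    have := hD (g (w i))
    rwa [hg'] at this
  rw [Finset.prod_mul_distrib, Finset.prod_const, Finset.card_univ, Fintype.card_fin] at h3
  calc _ ≤ _ := mul_le_mul_of_nonneg_left h3 (norm_nonneg _)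
    _ = _ := by ring

theorem aux_rpow {m k : ℕ} {p : ℝ} (hp : 1 ≤ p) (a b : ℝ≥0) {I J : ℝ≥0∞}
    (h : I ≤ ((a : ℝ≥0∞) ^ k) ^ p * ((b : ℝ≥0∞) ^ m * J)) :
    I ^ (1 / p) ≤ ENNReal.ofReal ((a : ℝ) ^ (k : ℝ) * (b : ℝ) ^ ((m : ℝ) / p)) * J ^ (1 / p) := by
  have hp0 : 0 < p := by linarith
  have h1 := ENNReal.rpow_le_rpow h (z := 1 / p) (by positivity)
  refine h1.trans (le_of_eq ?_)
  rw [ENNReal.mul_rpow_of_nonneg _ _ (by positivity), ENNReal.mul_rpow_of_nonneg _ _ (by positivity),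
    ← ENNReal.rpow_mul, mul_one_div_cancel hp0.ne', ENNReal.rpow_one, ← mul_assoc,
    ENNReal.ofReal_mul (by positivity), ← ENNReal.ofReal_rpow_of_nonneg (by positivity) (by positivity),
    ← ENNReal.ofReal_rpow_of_nonneg (by positivity) (by positivity), ENNReal.ofReal_coe_nnreal,
    ENNReal.ofReal_coe_nnreal, ENNReal.rpow_natCast, ← ENNReal.rpow_natCast (b : ℝ≥0∞),
    ← ENNReal.rpow_mul, mul_one_div]

/-- **Pullback bounds for `L^p` forms under bi-Lipschitz homeomorphisms.** If `Ψ : U → V` is a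
bi-Lipschitz homeomorphism between open subsets of `ℝᵐ` with Lipschitz constants `CΨ` and
`CΦ = C_{Ψ⁻¹}`, and `ω` is an `L^p` `k`-form on `V`, then `Ψ^*ω ∈ L^p(U)` and
`C_{Ψ⁻¹}^{-k} C_Ψ^{-m/p} ‖ω‖_{L^p(V)} ≤ ‖Ψ^*ω‖_{L^p(U)} ≤ C_Ψ^k C_{Ψ⁻¹}^{m/p} ‖ω‖_{L^p(V)}`. -/
theorem statement5 (m k : ℕ) (hm : 1 ≤ m) (hk : k ≤ m) (p : ℝ) (hp : 1 ≤ p)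
    {W : Type*} [NormedAddCommGroup W] [NormedSpace ℝ W] [FiniteDimensional ℝ W]
    (U V : Set (EuclideanSpace ℝ (Fin m))) (hU : IsOpen U) (hV : IsOpen V)
    (Ψ Φ : EuclideanSpace ℝ (Fin m) → EuclideanSpace ℝ (Fin m))
    (CΨ CΦ : ℝ≥0)
    (hbij : Set.BijOn Ψ U V)
    (hinv : ∀ x ∈ U, Φ (Ψ x) = x)
    (hlip : LipschitzOnWith CΨ Ψ U)
    (hlipinv : LipschitzOnWith CΦ Φ V)
    (ω : EuclideanSpace ℝ (Fin m) → FormSpace m k W)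
    (halt : ∀ y, IsAlternatingForm (ω y))
    (hmeas : AEStronglyMeasurable ω (volume.restrict V))
    (hLp : (∫⁻ y in V, (‖ω y‖₊ : ℝ≥0∞) ^ p) < ⊤) :
    AEStronglyMeasurable (formPullback Ψ ω) (volume.restrict U) ∧
    (∫⁻ x in U, (‖formPullback Ψ ω x‖₊ : ℝ≥0∞) ^ p) < ⊤ ∧
    ENNReal.ofReal ((CΦ : ℝ) ^ (-(k : ℝ)) * (CΨ : ℝ) ^ (-(m : ℝ) / p)) *
        (∫⁻ y in V, (‖ω y‖₊ : ℝ≥0∞) ^ p) ^ (1 / p) ≤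
      (∫⁻ x in U, (‖formPullback Ψ ω x‖₊ : ℝ≥0∞) ^ p) ^ (1 / p) ∧
    (∫⁻ x in U, (‖formPullback Ψ ω x‖₊ : ℝ≥0∞) ^ p) ^ (1 / p) ≤
      ENNReal.ofReal ((CΨ : ℝ) ^ (k : ℝ) * (CΦ : ℝ) ^ ((m : ℝ) / p)) *
        (∫⁻ y in V, (‖ω y‖₊ : ℝ≥0∞) ^ p) ^ (1 / p) := by
  have hp0 : 0 ≤ p := by linarith
  have hΨ : AEMeasurable Ψ (volume.restrict U) := hlip.continuousOn.aemeasurable hU.measurableSet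
  -- the two comparisons of measures
  have hA : (volume.restrict U).map Ψ ≤ ((CΦ : ℝ≥0∞) ^ m) • volume.restrict V := by
    refine Measure.le_iff.2 fun A hA => ?_
    rw [Measure.map_apply_of_aemeasurable hΨ hA, Measure.smul_apply, smul_eq_mul,
      Measure.restrict_apply hA, Measure.restrict_apply' hU.measurableSet]
    refine le_trans (measure_mono ?_)
      (aux_volume_image_le (hlipinv.mono (inter_subset_right : A ∩ V ⊆ V)))
    rintro x ⟨hxA, hxU⟩
    exact ⟨Ψ x, ⟨hxA, hbij.mapsTo hxU⟩, hinv x hxU⟩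
  have hB : volume.restrict V ≤ ((CΨ : ℝ≥0∞) ^ m) • (volume.restrict U).map Ψ := by
    refine Measure.le_iff.2 fun A hA => ?_
    rw [Measure.smul_apply, Measure.map_apply_of_aemeasurable hΨ hA, smul_eq_mul,
      Measure.restrict_apply hA, Measure.restrict_apply' hU.measurableSet]
    refine le_trans (measure_mono ?_)
      (aux_volume_image_le (hlip.mono (inter_subset_right : Ψ ⁻¹' A ∩ U ⊆ U)))
    rintro y ⟨hyA, hyV⟩
    obtain ⟨x, hx, rfl⟩ := hbij.surjOn hyV
    exact ⟨x, ⟨hyA, hx⟩, rfl⟩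
  have hac : (volume.restrict U).map Ψ ≪ volume.restrict V :=
    (Measure.absolutelyContinuous_of_le hA).trans Measure.smul_absolutelyContinuous
  have hmeas' : AEStronglyMeasurable ω ((volume.restrict U).map Ψ) := hmeas.mono_ac hac
  have hcomp : AEStronglyMeasurable (ω ∘ Ψ) (volume.restrict U) := hmeas'.comp_aemeasurable hΨ
  have hfd : AEStronglyMeasurable (fderiv ℝ Ψ) (volume.restrict U) :=
    (measurable_fderiv ℝ Ψ).aestronglyMeasurable
  have hpb : AEStronglyMeasurable (formPullback Ψ ω) (volume.restrict U) := by
    have hcont : Continuous fun q : FormSpace m k W ×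
        (EuclideanSpace ℝ (Fin m) →L[ℝ] EuclideanSpace ℝ (Fin m)) =>
        (ContinuousMultilinearMap.compContinuousLinearMapContinuousMultilinear ℝ
          (fun _ : Fin k => EuclideanSpace ℝ (Fin m)) (fun _ : Fin k => EuclideanSpace ℝ (Fin m)) W
          (fun _ => q.2)) q.1 := by
      refine Continuous.clm_apply ?_ continuous_fst
      exact (ContinuousMultilinearMap.cont _).comp (continuous_pi fun _ => continuous_snd)
    exact hcont.comp_aestronglyMeasurable (hcomp.prodMk hfd)
  have hmap : ∫⁻ y, (‖ω y‖₊ : ℝ≥0∞) ^ p ∂((volume.restrict U).map Ψ)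
      = ∫⁻ x in U, (‖ω (Ψ x)‖₊ : ℝ≥0∞) ^ p :=
    lintegral_map' (hmeas'.enorm.pow_const p) hΨ
  -- upper bound
  have hup : (∫⁻ x in U, (‖formPullback Ψ ω x‖₊ : ℝ≥0∞) ^ p) ≤
      ((CΨ : ℝ≥0∞) ^ k) ^ p * ((CΦ : ℝ≥0∞) ^ m * ∫⁻ y in V, (‖ω y‖₊ : ℝ≥0∞) ^ p) := by
    calc _ ≤ ∫⁻ x in U, ((CΨ : ℝ≥0∞) ^ k) ^ p * (‖ω (Ψ x)‖₊ : ℝ≥0∞) ^ p := by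
          refine setLIntegral_mono' hU.measurableSet fun x hx => ?_
          rw [← ENNReal.mul_rpow_of_nonneg _ _ hp0]
          refine ENNReal.rpow_le_rpow ?_ hp0
          have h1 := ContinuousMultilinearMap.norm_compContinuousLinearMap_le (ω (Ψ x))
            (fun _ : Fin k => fderiv ℝ Ψ x)
          rw [Finset.prod_const, Finset.card_univ, Fintype.card_fin] at h1
          have h2 := norm_fderiv_le_of_lipschitzOn ℝ (hU.mem_nhds hx) hlip
          have h3 : ‖formPullback Ψ ω x‖ ≤ (CΨ : ℝ) ^ k * ‖ω (Ψ x)‖ := by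
            refine h1.trans ?_
            rw [mul_comm]
            gcongr
          have h4 : ‖formPullback Ψ ω x‖₊ ≤ CΨ ^ k * ‖ω (Ψ x)‖₊ := by
            exact_mod_cast h3
          exact_mod_cast h4
      _ = ((CΨ : ℝ≥0∞) ^ k) ^ p * ∫⁻ x in U, (‖ω (Ψ x)‖₊ : ℝ≥0∞) ^ p :=
          lintegral_const_mul' _ _ (ENNReal.rpow_ne_top_of_nonneg hp0 (by simp))
      _ ≤ _ := by
          rw [← hmap]
          gcongr
          refine (lintegral_mono' hA le_rfl).trans ?_
          rw [lintegral_smul_measure, smul_eq_mul]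
  -- lower bound
  have hlow : (∫⁻ y in V, (‖ω y‖₊ : ℝ≥0∞) ^ p) ≤ ((CΦ : ℝ≥0∞) ^ k) ^ p *
      ((CΨ : ℝ≥0∞) ^ m * ∫⁻ x in U, (‖formPullback Ψ ω x‖₊ : ℝ≥0∞) ^ p) := by
    have hdiff : ∀ᵐ x ∂(volume.restrict U), DifferentiableWithinAt ℝ Ψ U x :=
      hlip.ae_differentiableWithinAt hU.measurableSet
    calc _ ≤ (CΨ : ℝ≥0∞) ^ m * ∫⁻ x in U, (‖ω (Ψ x)‖₊ : ℝ≥0∞) ^ p := by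
          rw [← hmap]
          refine (lintegral_mono' hB le_rfl).trans ?_
          rw [lintegral_smul_measure, smul_eq_mul]
      _ ≤ (CΨ : ℝ≥0∞) ^ m *
          ∫⁻ x in U, ((CΦ : ℝ≥0∞) ^ k) ^ p * (‖formPullback Ψ ω x‖₊ : ℝ≥0∞) ^ p := by
          refine mul_le_mul_right (lintegral_mono_ae ?_) _
          filter_upwards [hdiff, ae_restrict_mem hU.measurableSet] with x hxd hx
          rw [← ENNReal.mul_rpow_of_nonneg _ _ hp0]
          refine ENNReal.rpow_le_rpow ?_ hp0
          have h3 : ‖ω (Ψ x)‖ ≤ (CΦ : ℝ) ^ k * ‖formPullback Ψ ω x‖ :=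
            aux_form_lower (fderiv ℝ Ψ x) (aux_expand hU hbij hinv hlipinv hx
              (hxd.differentiableAt (hU.mem_nhds hx))) (ω (Ψ x))
          have h4 : ‖ω (Ψ x)‖₊ ≤ CΦ ^ k * ‖formPullback Ψ ω x‖₊ := by
            exact_mod_cast h3
          exact_mod_cast h4
      _ = _ := by
          rw [lintegral_const_mul' _ _ (ENNReal.rpow_ne_top_of_nonneg hp0 (by simp))]
          ring
  refine ⟨hpb, lt_of_le_of_lt hup ?_, ?_, aux_rpow hp CΨ CΦ hup⟩
  · exact ENNReal.mul_lt_top (ENNReal.rpow_lt_top_of_nonneg hp0 (by simp))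
      (ENNReal.mul_lt_top (by simp) hLp)
  · have h1 := aux_rpow hp CΦ CΨ hlow
    refine (mul_le_mul_right h1 _).trans ?_
    rw [← mul_assoc, ← ENNReal.ofReal_mul (by positivity), neg_div,
      Real.rpow_neg (by positivity), Real.rpow_neg (by positivity), ← mul_inv]
    refine (mul_le_mul_left (ENNReal.ofReal_le_one.2 inv_mul_le_one) _).trans ?_
    rw [one_mul]

end
end

section
/- Let m ≥ 1 and let A₁, A₂ : ℝ² → M_m(ℂ) be continuously differentiable matrix-valued functions. Set F(q) := ∂₁A₂(q) − ∂₂A₁(q) + A₁(q)A₂(q) − A₂(q)A₁(q) for q ∈ ℝ². Fix p ∈ ℝ². For ε > 0, let γ_ε : [0,4] → ℝ² be the counterclockwise parametrization of the boundary of the square p + [0,ε]² given by γ_ε(t) = p + tε e₁ for t ∈ [0,1], γ_ε(t) = p + ε e₁ + (t−1)ε e₂ for t ∈ [1,2], γ_ε(t) = p + ε e₁ + ε e₂ − (t−2)ε e₁ for t ∈ [2,3], γ_ε(t) = p + ε e₂ − (t−3)ε e₂ for t ∈ [3,4]. Let P_ε : [0,4] → M_m(ℂ) be any continuous map with P_ε(0)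 = Id which on each of the four open subintervals (0,1), (1,2), (2,3), (3,4) is differentiable and satisfies the linear ODE P_ε'(t) = P_ε(t)·(γ_ε'(t)₁ A₁(γ_ε(t)) + γ_ε'(t)₂ A₂(γ_ε(t))) (such a solution exists and is unique). Then ‖P_ε(4) − Id − ε² F(p)‖ / ε² → 0 as ε → 0⁺. -/
open Filter Topology Set

noncomputable section

/-- `m × m` complex matrices, realized as linear endomorphisms of `ℂᵐ` and equipped with the
(submultiplicative) operator norm. -/
abbrev Mat (m : ℕ) := EuclideanSpace ℂ (Fin m) →L[ℂ] EuclideanSpace ℂ (Fin m)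

/-- The counterclockwise parametrization `γ_ε : [0,4] → ℝ²` of the boundary of the square
`p + [0,ε]²`. -/
def sqPath (p : ℝ × ℝ) (ε t : ℝ) : ℝ × ℝ :=
  if t ≤ 1 then (p.1 + t * ε, p.2)
  else if t ≤ 2 then (p.1 + ε, p.2 + (t - 1) * ε)
  else if t ≤ 3 then (p.1 + ε - (t - 2) * ε, p.2 + ε)
  else (p.1, p.2 + ε - (t - 3) * ε)

lemma mv_aux {E : Type*} [NormedAddCommGroup E] [NormedSpace ℝ E] {f f' : ℝ → E} {C : ℝ}
    (hC : 0 ≤ C) (hc : ContinuousOn f (Icc 0 1))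
    (hd : ∀ t ∈ Ioo (0 : ℝ) 1, HasDerivAt f (f' t) t)
    (hb : ∀ t ∈ Ioo (0 : ℝ) 1, ‖f' t‖ ≤ C) :
    ∀ t ∈ Icc (0 : ℝ) 1, ‖f t - f 0‖ ≤ C := by
  have h1 : LipschitzOnWith C.toNNReal f (Ioo 0 1) := by
    apply (convex_Ioo (0 : ℝ) 1).lipschitzOnWith_of_nnnorm_hasDerivWithin_le
      (f' := f') (fun x hx => (hd x hx).hasDerivWithinAt)
    intro x hx
    rw [← NNReal.coe_le_coe, Real.coe_toNNReal _ hC]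
    exact hb x hx
  have h2 : LipschitzOnWith C.toNNReal f (Icc 0 1) := by
    have h := h1.closure (by rwa [closure_Ioo (by norm_num)])
    rwa [closure_Ioo (by norm_num)] at h
  intro t ht
  have := h2.norm_sub_le ht (left_mem_Icc.2 zero_le_one)
  rw [Real.coe_toNNReal _ hC] at this
  refine this.trans ?_
  have : ‖t - 0‖ ≤ 1 := by
    rw [sub_zero, Real.norm_eq_abs, abs_of_nonneg ht.1]; exact ht.2
  nlinarith

lemma edge_est {E : Type*} [NormedRing E] [NormedAlgebra ℝ E] {f B : ℝ → E} {B0 C D : E}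
    {e δ K L : ℝ} (hK : ‖B0‖ ≤ K ∧ ‖C‖ ≤ K ∧ ‖D‖ ≤ K) (hL : L = 3 * K + 1)
    (he : |e| * L ≤ 1 / 2) (hδ0 : 0 ≤ δ) (hδ : δ ≤ 1)
    (hc : ContinuousOn f (Icc 0 1))
    (hd : ∀ t ∈ Ioo (0 : ℝ) 1, HasDerivAt f (f t * (e • B t)) t)
    (hB : ∀ t ∈ Ioo (0 : ℝ) 1, ‖B t - (B0 + e • (C + t • D))‖ ≤ δ * |e|) :
    ‖f 1 - f 0 * (1 + e • B0 + e ^ 2 • (C + (1 / 2 : ℝ) • D + (1 / 2 : ℝ) • (B0 * B0)))‖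
      ≤ ‖f 0‖ * (2 * δ + 7 * L ^ 3 * |e|) * |e| ^ 2 := by
  obtain ⟨hK0, hKC, hKD⟩ := hK
  have K0 : 0 ≤ K := (norm_nonneg _).trans hK0
  have hL1 : 1 ≤ L := by linarith
  have he0 : 0 ≤ |e| := abs_nonneg e
  have he1 : |e| ≤ 1 := by nlinarith
  set F := ‖f 0‖ with hF
  have F0 : 0 ≤ F := norm_nonneg _
  have hCD : ∀ t ∈ Ioo (0 : ℝ) 1, ‖C + t • D‖ ≤ 2 * K := by
    intro t ht
    calc ‖C + t • D‖ ≤ ‖C‖ + ‖t • D‖ := norm_add_le _ _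
      _ ≤ 2 * K := by
        rw [norm_smul, Real.norm_eq_abs, abs_of_nonneg ht.1.le]
        nlinarith [ht.1, ht.2, norm_nonneg D]
  have hB0 : ∀ t ∈ Ioo (0 : ℝ) 1, ‖B t - B0‖ ≤ L * |e| := by
    intro t ht
    calc ‖B t - B0‖ = ‖(B t - (B0 + e • (C + t • D))) + e • (C + t • D)‖ := by congr 1; abel
      _ ≤ _ := norm_add_le _ _
      _ ≤ δ * |e| + |e| * (2 * K) := by
        rw [norm_smul, Real.norm_eq_abs]
        exact add_le_add (hB t ht) (mul_le_mul_of_nonneg_left (hCD t ht) he0)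
      _ ≤ L * |e| := by nlinarith
  have hBt : ∀ t ∈ Ioo (0 : ℝ) 1, ‖B t‖ ≤ L := by
    intro t ht
    calc ‖B t‖ = ‖(B t - (B0 + e • (C + t • D))) + (B0 + e • (C + t • D))‖ := by congr 1; abel
      _ ≤ ‖B t - (B0 + e • (C + t • D))‖ + (‖B0‖ + ‖e • (C + t • D)‖) := 
        (norm_add_le _ _).trans (add_le_add le_rfl (norm_add_le _ _))
      _ ≤ δ * |e| + (K + |e| * (2 * K)) := by
        rw [norm_smul, Real.norm_eq_abs]
        exact add_le_add (hB t ht) (add_le_add hK0 (mul_le_mul_of_nonneg_left (hCD t ht) he0))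
      _ ≤ L := by nlinarith
  -- a priori bound
  obtain ⟨s, hs, hmax⟩ := isCompact_Icc.exists_isMaxOn (nonempty_Icc.2 (zero_le_one (α := ℝ)))
    hc.norm
  have hmax' : ∀ t ∈ Icc (0 : ℝ) 1, ‖f t‖ ≤ ‖f s‖ := fun t ht => hmax ht
  have hM0 := norm_nonneg (f s)
  have hder : ∀ t ∈ Ioo (0 : ℝ) 1, ‖f t * (e • B t)‖ ≤ ‖f s‖ * (|e| * L) := by
    intro t ht
    refine (norm_mul_le _ _).trans ?_
    rw [norm_smul, Real.norm_eq_abs]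
    exact mul_le_mul (hmax' t (Ioo_subset_Icc_self ht))
      (mul_le_mul_of_nonneg_left (hBt t ht) he0) (by positivity) hM0
  have hdiff := mv_aux (by positivity) hc hd hder
  have hM : ‖f s‖ ≤ 2 * F := by
    have h1 := hdiff s hs
    have h2 : ‖f s‖ ≤ ‖f s - f 0‖ + ‖f 0‖ := by simpa using norm_add_le (f s - f 0) (f 0)
    nlinarith
  have hft : ∀ t ∈ Icc (0 : ℝ) 1, ‖f t‖ ≤ 2 * F := fun t ht => (hmax' t ht).trans hM
  have hd1 : ∀ t ∈ Icc (0 : ℝ) 1, ‖f t - f 0‖ ≤ 2 * F * (|e| * L) := fun t ht =>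
    (hdiff t ht).trans (mul_le_mul_of_nonneg_right hM (by positivity))
  -- first order
  have hd2 : ∀ t ∈ Icc (0 : ℝ) 1, ‖f t - f 0 * (1 + t • e • B0)‖ ≤ 3 * L ^ 2 * F * |e| ^ 2 := by
    have key := mv_aux (f := fun t => f t - f 0 * (1 + t • e • B0))
      (f' := fun t => f t * (e • B t) - f 0 * (e • B0)) (C := 3 * L ^ 2 * F * |e| ^ 2)
      (by positivity) (hc.sub (by fun_prop)) ?_ ?_
    · simpa using key
    · intro t ht
      refine (hd t ht).sub ?_
      simpa using (((hasDerivAt_id t).smul_const (e • B0)).const_add 1).const_mul (f 0)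
    · intro t ht
      have : f t * (e • B t) - f 0 * (e • B0) = e • ((f t - f 0) * B t + f 0 * (B t - B0)) := by
        simp only [mul_smul_comm, sub_mul, mul_sub]; module
      rw [this, norm_smul, Real.norm_eq_abs]
      have h1 : ‖(f t - f 0) * B t‖ ≤ 2 * F * (|e| * L) * L :=
        (norm_mul_le _ _).trans (mul_le_mul (hd1 t (Ioo_subset_Icc_self ht)) (hBt t ht)
          (norm_nonneg _) (by positivity))
      have h2 : ‖f 0 * (B t - B0)‖ ≤ F * (L * |e|) :=
        (norm_mul_le _ _).trans (mul_le_mul_of_nonneg_left (hB0 t ht) F0)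
      have h3 := norm_add_le ((f t - f 0) * B t) (f 0 * (B t - B0))
      have h4 : F * (L * |e|) ≤ F * |e| * L ^ 2 := by
        have : F * |e| * L ≤ F * |e| * L ^ 2 :=
          mul_le_mul_of_nonneg_left (by nlinarith) (by positivity)
        linarith
      calc _ ≤ |e| * (3 * L ^ 2 * F * |e|) := mul_le_mul_of_nonneg_left (by nlinarith) he0
        _ = _ := by ring
  -- second order
  have key := mv_aux
    (f := fun t => f t - f 0 * (1 + t • e • B0 + e ^ 2 • (t • C + (t ^ 2 / 2) • D
      + (t ^ 2 / 2) • (B0 * B0))))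
    (f' := fun t => f t * (e • B t) - f 0 * (e • B0 + e ^ 2 • (C + t • D + t • (B0 * B0))))
    (C := F * (2 * δ + 7 * L ^ 3 * |e|) * |e| ^ 2)
    (by positivity) (hc.sub (by fun_prop)) ?_ ?_
  · have := key 1 (right_mem_Icc.2 zero_le_one)
    simpa using this
  · intro t ht
    refine (hd t ht).sub ?_
    refine HasDerivAt.const_mul (f 0) ?_
    have hsq : HasDerivAt (fun t : ℝ => t ^ 2 / 2) t t := by
      have := (hasDerivAt_pow 2 t).div_const 2
      simpa using this
    have h1 := ((hasDerivAt_id t).smul_const (e • B0)).const_add 1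
    have h2 := ((((hasDerivAt_id t).smul_const C).add (hsq.smul_const D)).add
      (hsq.smul_const (B0 * B0))).const_smul (e ^ 2)
    have h3 := h1.add h2
    exact h3.congr_deriv (by simp)
  · intro t ht
    have : f t * (e • B t) - f 0 * (e • B0 + e ^ 2 • (C + t • D + t • (B0 * B0)))
        = e • (f t * (B t - (B0 + e • (C + t • D))) + (f t - f 0 * (1 + t • e • B0)) * B0
          + e • ((f t - f 0) * (C + t • D))) := by
      simp only [mul_smul_comm, smul_mul_assoc, sub_mul, mul_sub, mul_add, add_mul, mul_one,
        mul_assoc]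
      module
    have ht' := Ioo_subset_Icc_self ht
    have h1 : ‖f t * (B t - (B0 + e • (C + t • D)))‖ ≤ 2 * F * (δ * |e|) :=
      (norm_mul_le _ _).trans (mul_le_mul (hft t ht') (hB t ht) (norm_nonneg _) (by positivity))
    have h2 : ‖(f t - f 0 * (1 + t • e • B0)) * B0‖ ≤ 3 * L ^ 2 * F * |e| ^ 2 * L :=
      (norm_mul_le _ _).trans (mul_le_mul (hd2 t ht') (by linarith) (norm_nonneg _)
        (by positivity))
    have h3 : ‖e • ((f t - f 0) * (C + t • D))‖ ≤ |e| * (2 * F * (|e| * L) * (2 * L)) := by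
      rw [norm_smul, Real.norm_eq_abs]
      refine mul_le_mul_of_nonneg_left ((norm_mul_le _ _).trans (mul_le_mul (hd1 t ht') ?_
        (norm_nonneg _) (by positivity))) he0
      linarith [hCD t ht]
    have h4 : F * |e| ^ 2 * L ^ 2 ≤ F * |e| ^ 2 * L ^ 3 :=
      mul_le_mul_of_nonneg_left (by nlinarith [sq_nonneg L]) (by positivity)
    rw [this, norm_smul, Real.norm_eq_abs]
    calc _ ≤ |e| * (2 * F * (δ * |e|) + 3 * L ^ 2 * F * |e| ^ 2 * L
            + |e| * (2 * F * (|e| * L) * (2 * L))) :=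
          mul_le_mul_of_nonneg_left ((norm_add_le _ _).trans (add_le_add
            ((norm_add_le _ _).trans (add_le_add h1 h2)) h3)) he0
      _ ≤ |e| * (F * (2 * δ + 7 * L ^ 3 * |e|) * |e|) :=
          mul_le_mul_of_nonneg_left (by nlinarith) he0
      _ = _ := by ring

def Jet {E : Type*} [NormedRing E] [NormedAlgebra ℝ E] (U : ℝ → E) (X Y : E) : Prop :=
  (fun ε : ℝ => U ε - (1 + ε • X + ε ^ 2 • Y)) =o[𝓝[>] (0 : ℝ)] (fun ε : ℝ => ε ^ 2)

lemma Jet.tendsto {E : Type*} [NormedRing E] [NormedAlgebra ℝ E] {U : ℝ → E} {X Y : E}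
    (h : Jet U X Y) : Tendsto U (𝓝[>] (0 : ℝ)) (𝓝 1) := by
  have h0 : Tendsto (fun ε : ℝ => ε ^ 2) (𝓝[>] (0 : ℝ)) (𝓝 0) := by
    have : Continuous (fun ε : ℝ => ε ^ 2) := by fun_prop
    simpa using (this.tendsto 0).mono_left nhdsWithin_le_nhds
  have h1 := Asymptotics.IsLittleO.trans_tendsto h h0
  have h2 : Tendsto (fun ε : ℝ => 1 + ε • X + ε ^ 2 • Y) (𝓝[>] (0 : ℝ)) (𝓝 1) := by
    have : Continuous (fun ε : ℝ => 1 + ε • X + ε ^ 2 • Y) := by fun_prop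
    simpa using (this.tendsto 0).mono_left nhdsWithin_le_nhds
  simpa using h1.add h2

lemma Jet.step {E : Type*} [NormedRing E] [NormedAlgebra ℝ E] {U V : ℝ → E} {X Y X' Y' : E}
    (h : Jet U X Y)
    (hV : (fun ε : ℝ => V ε - U ε * (1 + ε • X' + ε ^ 2 • Y')) =o[𝓝[>] (0 : ℝ)]
      (fun ε : ℝ => ε ^ 2)) :
    Jet V (X + X') (Y + Y' + X * X') := by
  have hT : (fun ε : ℝ => 1 + ε • X' + ε ^ 2 • Y') =O[𝓝[>] (0 : ℝ)] (fun _ : ℝ => (1 : ℝ)) := by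
    have : Continuous (fun ε : ℝ => 1 + ε • X' + ε ^ 2 • Y') := by fun_prop
    exact ((this.tendsto 0).mono_left nhdsWithin_le_nhds).isBigO_one ℝ
  have h1 : (fun ε : ℝ => (U ε - (1 + ε • X + ε ^ 2 • Y)) * (1 + ε • X' + ε ^ 2 • Y'))
      =o[𝓝[>] (0 : ℝ)] (fun ε : ℝ => ε ^ 2) := by
    simpa using Asymptotics.IsLittleO.mul_isBigO h hT
  have h2 : (fun ε : ℝ => ε ^ 3 • (X * Y' + Y * X' + ε • (Y * Y')))
      =o[𝓝[>] (0 : ℝ)] (fun ε : ℝ => ε ^ 2) := by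
    have ha : (fun ε : ℝ => ε ^ 3) =o[𝓝[>] (0 : ℝ)] (fun ε : ℝ => ε ^ 2) :=
      (Asymptotics.isLittleO_pow_pow (by norm_num)).mono nhdsWithin_le_nhds
    have hb : (fun ε : ℝ => X * Y' + Y * X' + ε • (Y * Y')) =O[𝓝[>] (0 : ℝ)]
        (fun _ : ℝ => (1 : ℝ)) := by
      have : Continuous (fun ε : ℝ => X * Y' + Y * X' + ε • (Y * Y')) := by fun_prop
      exact ((this.tendsto 0).mono_left nhdsWithin_le_nhds).isBigO_one ℝ
    simpa using ha.smul_isBigO hb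
  refine ((hV.add h1).add h2).congr_left ?_
  intro ε
  simp only [mul_smul_comm, smul_mul_assoc, sub_mul, mul_add, add_mul, mul_one, one_mul]
  module

lemma edge_jet {E : Type*} [NormedRing E] [NormedAlgebra ℝ E] {A : ℝ × ℝ → E}
    {A' : ℝ × ℝ →L[ℝ] E} {p u v : ℝ × ℝ} (hA : HasFDerivAt A A' p) (a σ : ℝ)
    (hσ : |σ| = 1) (P : ℝ → ℝ → E) {X Y : E}
    (hP : Jet (fun ε => P ε a) X Y)
    (hc : ∀ ε : ℝ, 0 < ε → ContinuousOn (P ε) (Icc a (a + 1)))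
    (hd : ∀ ε : ℝ, 0 < ε → ∀ t ∈ Ioo a (a + 1),
      HasDerivAt (P ε) (P ε t * ((σ * ε) • A (p + ε • (u + (t - a) • v)))) t) :
    Jet (fun ε => P ε (a + 1)) (X + σ • A p)
      (Y + (σ • (A' u + (1 / 2 : ℝ) • A' v) + (1 / 2 : ℝ) • (A p * A p)) + X * (σ • A p)) := by
  have hσ2 : σ * σ = 1 := by rw [← abs_mul_abs_self, hσ, one_mul]
  refine hP.step ?_
  set K := max ‖A p‖ (max ‖A' u‖ ‖A' v‖) with hK
  set L := 3 * K + 1 with hL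
  have K0 : 0 ≤ K := (norm_nonneg _).trans (le_max_left _ _)
  have hL1 : 1 ≤ L := by linarith
  rw [Asymptotics.isLittleO_iff]
  intro c hc0
  -- choose δ
  obtain ⟨δ, hδ0, hδ1, hδc⟩ : ∃ δ : ℝ, 0 < δ ∧ δ ≤ 1 ∧ ‖(1 : E)‖ * (2 * δ) < c := by
    have hM : 0 < ‖(1 : E)‖ + 1 := by positivity
    refine ⟨min 1 (c / (2 * (‖(1 : E)‖ + 1))), by positivity, min_le_left _ _, ?_⟩
    have hδ0 : 0 < min 1 (c / (2 * (‖(1 : E)‖ + 1))) := by positivity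
    have h := min_le_right 1 (c / (2 * (‖(1 : E)‖ + 1)))
    rw [le_div_iff₀ (by positivity)] at h
    nlinarith
  set N := ‖u‖ + ‖v‖ + 1 with hN
  have hN0 : 0 < N := by positivity
  have hlo := hA.isLittleO
  rw [Asymptotics.isLittleO_iff] at hlo
  have hlo := hlo (c := δ / N) (by positivity)
  obtain ⟨r, hr, hball⟩ := Metric.eventually_nhds_iff.1 hlo
  have e2 : ∀ᶠ ε in 𝓝[>] (0 : ℝ), ε * N < r := by
    have : Continuous (fun ε : ℝ => ε * N) := by fun_prop
    exact ((this.tendsto 0).mono_left nhdsWithin_le_nhds).eventually_lt_const (by simpa using hr)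
  have e3 : ∀ᶠ ε in 𝓝[>] (0 : ℝ), ε * L < 1 / 2 := by
    have : Continuous (fun ε : ℝ => ε * L) := by fun_prop
    exact ((this.tendsto 0).mono_left nhdsWithin_le_nhds).eventually_lt_const (by norm_num)
  have e5 : ∀ᶠ ε in 𝓝[>] (0 : ℝ), ‖P ε a‖ * (2 * δ + 7 * L ^ 3 * ε) < c := by
    have hcont : Continuous (fun ε : ℝ => 2 * δ + 7 * L ^ 3 * ε) := by fun_prop
    have ht := hP.tendsto.norm.mul ((hcont.tendsto 0).mono_left
      (nhdsWithin_le_nhds (s := Ioi (0 : ℝ))))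
    exact ht.eventually_lt_const (by simpa using hδc)
  filter_upwards [e2, e3, e5, self_mem_nhdsWithin] with ε h2 h3 h5 hε
  have hε : 0 < ε := hε
  have habs : |σ * ε| = ε := by rw [abs_mul, hσ, one_mul, abs_of_pos hε]
  have key := edge_est (f := fun t => P ε (a + t)) (B := fun t => A (p + ε • (u + t • v)))
    (B0 := A p) (C := σ • A' u) (D := σ • A' v) (e := σ * ε) (δ := δ) (K := K) (L := L)
    ⟨le_max_left _ _, by
      rw [norm_smul, Real.norm_eq_abs, hσ, one_mul]
      exact (le_max_left _ _).trans (le_max_right _ _), by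
      rw [norm_smul, Real.norm_eq_abs, hσ, one_mul]
      exact (le_max_right _ _).trans (le_max_right _ _)⟩ hL (by rw [habs]; exact h3.le) hδ0.le hδ1
    ?_ ?_ ?_
  · rw [habs] at key
    simp only [add_zero] at key
    rw [Real.norm_of_nonneg (by positivity)]
    refine le_trans (le_of_eq ?_) (key.trans (mul_le_mul_of_nonneg_right h5.le (by positivity)))
    congr 4
    · rw [smul_smul, mul_comm]
    · have : (σ * ε) ^ 2 = ε ^ 2 := by rw [mul_pow, pow_two σ, hσ2, one_mul]
      rw [this]; module
  · refine (hc ε hε).comp (by fun_prop) ?_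
    intro t ht
    exact ⟨by linarith [ht.1], by linarith [ht.2]⟩
  · intro t ht
    have := hd ε hε (a + t) ⟨by linarith [ht.1], by linarith [ht.2]⟩
    have := this.comp_const_add a t
    simpa using this
  · intro t ht
    rw [habs]
    have hw : ‖u + t • v‖ ≤ N := by
      refine (norm_add_le _ _).trans ?_
      rw [norm_smul, Real.norm_eq_abs, abs_of_pos ht.1]
      nlinarith [ht.2, norm_nonneg v]
    have hw2 : ‖ε • (u + t • v)‖ ≤ ε * N := by
      rw [norm_smul, Real.norm_eq_abs, abs_of_pos hε]
      exact mul_le_mul_of_nonneg_left hw hε.le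
    have := hball (y := p + ε • (u + t • v)) (by
      rw [dist_eq_norm, add_sub_cancel_left]; exact hw2.trans_lt h2)
    rw [add_sub_cancel_left] at this
    have heq : A (p + ε • (u + t • v)) - (A p + (σ * ε) • (σ • A' u + t • σ • A' v))
        = A (p + ε • (u + t • v)) - A p - A' (ε • (u + t • v)) := by
      simp only [map_smul, map_add]
      have : (σ * ε) • (σ • A' u + t • σ • A' v) = (σ * σ) • (ε • (A' u + t • A' v)) := by module
      rw [this, hσ2, one_smul]; abel
    rw [heq]
    refine this.trans ?_
    calc δ / N * ‖ε • (u + t • v)‖ ≤ δ / N * (ε * N) :=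
          mul_le_mul_of_nonneg_left hw2 (by positivity)
      _ = δ * ε := by field_simp

theorem holonomy_abs {E : Type*} [NormedRing E] [NormedAlgebra ℝ E]
    (A₁ A₂ : ℝ × ℝ → E) (h1 : ContDiff ℝ 1 A₁) (h2 : ContDiff ℝ 1 A₂)
    (p : ℝ × ℝ)
    (P : ℝ → ℝ → E)
    (hcont : ∀ ε : ℝ, 0 < ε → ContinuousOn (P ε) (Icc (0 : ℝ) 4))
    (hinit : ∀ ε : ℝ, 0 < ε → P ε 0 = 1)
    (hode1 : ∀ ε : ℝ, 0 < ε → ∀ t ∈ Ioo (0 : ℝ) 1,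
      HasDerivAt (P ε) (P ε t * (ε • A₁ (sqPath p ε t))) t)
    (hode2 : ∀ ε : ℝ, 0 < ε → ∀ t ∈ Ioo (1 : ℝ) 2,
      HasDerivAt (P ε) (P ε t * (ε • A₂ (sqPath p ε t))) t)
    (hode3 : ∀ ε : ℝ, 0 < ε → ∀ t ∈ Ioo (2 : ℝ) 3,
      HasDerivAt (P ε) (P ε t * ((-ε) • A₁ (sqPath p ε t))) t)
    (hode4 : ∀ ε : ℝ, 0 < ε → ∀ t ∈ Ioo (3 : ℝ) 4,
      HasDerivAt (P ε) (P ε t * ((-ε) • A₂ (sqPath p ε t))) t) :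
    Tendsto
      (fun ε : ℝ =>
        ‖P ε 4 - 1 -
            ε ^ 2 •
              (fderiv ℝ A₂ p ((1 : ℝ), (0 : ℝ)) - fderiv ℝ A₁ p ((0 : ℝ), (1 : ℝ)) +
                A₁ p * A₂ p - A₂ p * A₁ p)‖ / ε ^ 2)
      (𝓝[>] (0 : ℝ)) (𝓝 0) := by
  have hA1 := (h1.differentiable one_ne_zero p).hasFDerivAt
  have hA2 := (h2.differentiable one_ne_zero p).hasFDerivAt
  have j0 : Jet (fun ε => P ε 0) (0 : E) 0 := by
    have h : (fun ε : ℝ => P ε 0 - (1 + ε • (0 : E) + ε ^ 2 • (0 : E)))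
        =ᶠ[𝓝[>] (0 : ℝ)] fun _ => (0 : E) := by
      filter_upwards [self_mem_nhdsWithin] with ε hε
      rw [hinit ε hε]; simp
    exact h.trans_isLittleO (Asymptotics.isLittleO_zero _ _)
  have j1 := edge_jet (u := (0, 0)) (v := (1, 0)) hA1 0 1 (by norm_num) P j0
    (fun ε hε => (hcont ε hε).mono (Icc_subset_Icc (by norm_num) (by norm_num))) (by
      intro ε hε t ht
      rw [zero_add] at ht
      convert hode1 ε hε t ht using 3
      · ring
      · refine congrArg _ (Prod.ext ?_ ?_) <;> simp [sqPath, ht.2.le] <;> ring)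
  rw [show (0 : ℝ) + 1 = 1 by norm_num] at j1
  have j2 := edge_jet (u := (1, 0)) (v := (0, 1)) hA2 1 1 (by norm_num) P j1
    (fun ε hε => (hcont ε hε).mono (Icc_subset_Icc (by norm_num) (by norm_num))) (by
      intro ε hε t ht
      rw [show (1 : ℝ) + 1 = 2 by norm_num] at ht
      convert hode2 ε hε t ht using 3
      · ring
      · refine congrArg _ (Prod.ext ?_ ?_) <;> simp [sqPath, ht.2.le, ht.1.not_ge] <;> ring)
  rw [show (1 : ℝ) + 1 = 2 by norm_num] at j2
  have j3 := edge_jet (u := (1, 1)) (v := (-1, 0)) hA1 2 (-1) (by norm_num) P j2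
    (fun ε hε => (hcont ε hε).mono (Icc_subset_Icc (by norm_num) (by norm_num))) (by
      intro ε hε t ht
      rw [show (2 : ℝ) + 1 = 3 by norm_num] at ht
      convert hode3 ε hε t ht using 3
      · ring
      · have : ¬ t ≤ 1 := by linarith [ht.1]
        refine congrArg _ (Prod.ext ?_ ?_) <;> simp [sqPath, ht.2.le, ht.1.not_ge, this] <;> ring)
  rw [show (2 : ℝ) + 1 = 3 by norm_num] at j3
  have j4 := edge_jet (u := (0, 1)) (v := (0, -1)) hA2 3 (-1) (by norm_num) P j3
    (fun ε hε => (hcont ε hε).mono (Icc_subset_Icc (by norm_num) (by norm_num))) (by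
      intro ε hε t ht
      rw [show (3 : ℝ) + 1 = 4 by norm_num] at ht
      convert hode4 ε hε t ht using 3
      · ring
      · have h1 : ¬ t ≤ 1 := by linarith [ht.1]
        have h2 : ¬ t ≤ 2 := by linarith [ht.1]
        refine congrArg _ (Prod.ext ?_ ?_) <;> simp [sqPath, ht.1.not_ge, h1, h2] <;> ring)
  rw [show (3 : ℝ) + 1 = 4 by norm_num] at j4
  have s1 : ∀ A : ℝ × ℝ →L[ℝ] E, A (1, 1) = A (1, 0) + A (0, 1) := fun A => by
    rw [← map_add]; simp
  have s2 : ∀ A : ℝ × ℝ →L[ℝ] E, A (-1, 0) = - A (1, 0) := fun A => by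
    rw [← map_neg]; simp
  have s3 : ∀ A : ℝ × ℝ →L[ℝ] E, A (0, -1) = - A (0, 1) := fun A => by
    rw [← map_neg]; simp
  have s4 : ∀ A : ℝ × ℝ →L[ℝ] E, A (0, 0) = 0 := fun A => map_zero A
  have j5 := (Asymptotics.isLittleO_iff_tendsto' (by
    filter_upwards [self_mem_nhdsWithin] with ε hε h0
    exact absurd h0 (pow_ne_zero 2 (ne_of_gt hε)))).1 (Asymptotics.IsLittleO.norm_left j4)
  refine j5.congr (fun ε => ?_)
  congr 2
  rw [s1, s2, s3, s4]
  simp only [mul_smul_comm, smul_mul_assoc, mul_add, add_mul, zero_mul, zero_add]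
  module


/-- **The curvature is the infinitesimal holonomy around small squares.** Let `A₁, A₂` be `C¹`
matrix-valued functions on `ℝ²`, let `F := ∂₁A₂ − ∂₂A₁ + A₁A₂ − A₂A₁` be the curvature of the
connection form `A₁ dx₁ + A₂ dx₂`, and for `ε > 0` let `P_ε` solve the parallel-transport ODE
`P' = P⬝(γ'₁ A₁(γ) + γ'₂ A₂(γ))`, `P(0) = Id`, along the boundary `γ_ε` of the square
`p + [0,ε]²`.  Then `P_ε(4) = Id + ε² F(p) + o(ε²)` as `ε → 0⁺`. -/
theorem statement6 (m : ℕ) (hm : 1 ≤ m)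
    (A₁ A₂ : ℝ × ℝ → Mat m) (h1 : ContDiff ℝ 1 A₁) (h2 : ContDiff ℝ 1 A₂)
    (p : ℝ × ℝ)
    (P : ℝ → ℝ → Mat m)
    (hcont : ∀ ε : ℝ, 0 < ε → ContinuousOn (P ε) (Icc (0 : ℝ) 4))
    (hinit : ∀ ε : ℝ, 0 < ε → P ε 0 = 1)
    (hode1 : ∀ ε : ℝ, 0 < ε → ∀ t ∈ Ioo (0 : ℝ) 1,
      HasDerivAt (P ε) (P ε t * (ε • A₁ (sqPath p ε t))) t)
    (hode2 : ∀ ε : ℝ, 0 < ε → ∀ t ∈ Ioo (1 : ℝ) 2,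
      HasDerivAt (P ε) (P ε t * (ε • A₂ (sqPath p ε t))) t)
    (hode3 : ∀ ε : ℝ, 0 < ε → ∀ t ∈ Ioo (2 : ℝ) 3,
      HasDerivAt (P ε) (P ε t * ((-ε) • A₁ (sqPath p ε t))) t)
    (hode4 : ∀ ε : ℝ, 0 < ε → ∀ t ∈ Ioo (3 : ℝ) 4,
      HasDerivAt (P ε) (P ε t * ((-ε) • A₂ (sqPath p ε t))) t) :
    Tendsto
      (fun ε : ℝ =>
        ‖P ε 4 - 1 -
            ε ^ 2 •
              (fderiv ℝ A₂ p ((1 : ℝ), (0 : ℝ)) - fderiv ℝ A₁ p ((0 : ℝ), (1 : ℝ)) +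
                A₁ p * A₂ p - A₂ p * A₁ p)‖ / ε ^ 2)
      (𝓝[>] (0 : ℝ)) (𝓝 0) := by
  let : Algebra ℝ (Mat m) := Algebra.ofModule (fun r x y => rfl)
    (fun r x y => by
      ext1 v
      exact x.map_smul_of_tower r (y v))
  let : NormedAlgebra ℝ (Mat m) := { norm_smul_le := fun r x => norm_smul_le r x }
  exact holonomy_abs A₁ A₂ h1 h2 p P hcont hinit hode1 hode2 hode3 hode4

end
end
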